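/- arXiv:2402.15093 — 3 statements merged into one kernel-verified Lean document; each statement's English description precedes it below -/
import Mathlib

section
/- Let l be a positive integer, n a nonzero integer, λ a nonnegative integer, and let c : (ℤ/|n|ℤ) × (ℤ/2lℤ) → ℂ be a family of coefficients. Set G = Σ_{a ∈ ℤ/|n|ℤ, b ∈ ℤ/2lℤ} c^{a,b} · W_n^{a,b}F_{n,λ} (a finite sum, where W_n^{a,b} denotes the Weil–Brezin transform associated to the lattice N_{2l}, indexed by the representatives 0 ≤ j ≤ |n|−1 of a and 0 ≤ u ≤ 2l−1 of b). Then: (i) if n > 0, G ∘ φ = G if and only if e^{πi(n+λ)} c^{a,0} = c^{−a,0} for all a ∈ ℤ/nℤ and e^{πi(n+λ)} c^{a,b} = c^{−a−1,−b} for all a ∈ ℤ/nℤ and all b ≠ 0 in ℤ/2lℤ; (ii) if n < 0, G ∘ φ = G if and only if e^{πi(n+λ)} c^{a,0} = c^{−a,0} for all a ∈ ℤ/|n|ℤ and e^{πi(n+λ)} c^{a,b} = c^{−a+1,−b} for all a ∈ ℤ/|n|ℤ and all b ≠ 0 in ℤ/2lℤ. -/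
noncomputable section

abbrev H3 := ℝ × ℝ × ℝ

/-- the map φ(p,q,s) = (−p, −q, s + 1/2) -/
def phi : H3 → H3 := fun x => (-x.1, -x.2.1, x.2.2 + 1 / 2)

/-- Weil–Brezin transform associated to the lattice N_l -/
def WB (l : ℕ) (n j u : ℤ) (g : ℝ → ℂ) : H3 → ℂ := fun x =>
  Complex.exp (2 * Real.pi * Complex.I * (n : ℂ) * (x.2.2 : ℂ)) *
    ∑' k : ℤ,
      g (x.1 + (k : ℝ) + (j : ℝ) / |(n : ℝ)| + (u : ℝ) / ((l : ℝ) * (n : ℝ))) *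
        Complex.exp (2 * Real.pi * Complex.I * (n : ℂ) *
          ((((k : ℝ) + (j : ℝ) / |(n : ℝ)| + (u : ℝ) / ((l : ℝ) * (n : ℝ))) : ℝ) : ℂ) *
          (x.2.1 : ℂ))

/-- physicists' Hermite polynomials: H₀ = 1, H_{λ+1} = 2X·H_λ − H_λ' -/
def physHermite : ℕ → Polynomial ℝ
  | 0 => 1
  | (lam + 1) => 2 * Polynomial.X * physHermite lam - (physHermite lam).derivative

/-- F_{n,λ}(x) = H_λ(√(2π|n|) x) e^{−π|n|x²} -/
def Fnl (n : ℤ) (lam : ℕ) : ℝ → ℂ := fun x =>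
  (((physHermite lam).eval (Real.sqrt (2 * Real.pi * |(n : ℝ)|) * x) *
    Real.exp (-Real.pi * |(n : ℝ)| * x ^ 2) : ℝ) : ℂ)

open Polynomial in
theorem physHermite_comp_neg_X (lam : ℕ) :
    (physHermite lam).comp (-X) = (-1) ^ lam * physHermite lam := by
  induction lam with
  | zero => simp [physHermite]
  | succ k ih =>
    have hd : (physHermite k).derivative.comp (-X) =
        (-1) ^ (k + 1) * (physHermite k).derivative := by
      have h := congrArg derivative ih
      rw [derivative_comp] at h
      have h1 : derivative ((-1 : ℝ[X]) ^ k) = 0 := by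
        rcases neg_one_pow_eq_or ℝ[X] k with h | h <;> simp [h]
      simp only [derivative_neg, derivative_X, derivative_mul, h1] at h
      rw [pow_succ]
      linear_combination -h
    simp only [physHermite, sub_comp, mul_comp, ofNat_comp, X_comp, hd, ih]
    ring

theorem Fnl_neg (n : ℤ) (lam : ℕ) (x : ℝ) : Fnl n lam (-x) = (-1) ^ lam * Fnl n lam x := by
  have h := congrArg
    (Polynomial.eval (Real.sqrt (2 * Real.pi * |(n : ℝ)|) * x)) (physHermite_comp_neg_X lam)
  simp only [Polynomial.eval_comp, Polynomial.eval_neg, Polynomial.eval_X, Polynomial.eval_mul,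
    Polynomial.eval_pow, Polynomial.eval_one] at h
  simp only [Fnl, mul_neg, h]
  push_cast
  rw [neg_sq]
  ring

theorem physHermite_coeff (lam : ℕ) :
    (physHermite lam).coeff lam = 2 ^ lam ∧ ∀ k, lam < k → (physHermite lam).coeff k = 0 := by
  induction lam with
  | zero =>
    refine ⟨by simp [physHermite], fun k hk => ?_⟩
    simp [physHermite, Polynomial.coeff_one, hk.ne']
  | succ d ih =>
    have key (k : ℕ) : (physHermite (d + 1)).coeff (k + 1) =
        2 * (physHermite d).coeff k - (physHermite d).coeff (k + 2) * (k + 2) := by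
      have : physHermite (d + 1) = Polynomial.C 2 * (Polynomial.X * physHermite d) -
          (physHermite d).derivative := by
        rw [physHermite, ← mul_assoc]; rfl
      rw [this, Polynomial.coeff_sub, Polynomial.coeff_C_mul, Polynomial.coeff_X_mul,
        Polynomial.coeff_derivative]
      push_cast
      ring
    refine ⟨?_, fun k hk => ?_⟩
    · rw [key, ih.1, ih.2 _ (by omega)]; ring
    · obtain ⟨k, rfl⟩ : ∃ j, k = j + 1 := ⟨k - 1, by omega⟩
      rw [key, ih.2 _ (by omega), ih.2 _ (by omega)]; ring

theorem physHermite_ne_zero (lam : ℕ) : physHermite lam ≠ 0 := by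
  intro h
  have := (physHermite_coeff lam).1
  rw [h, Polynomial.coeff_zero] at this
  exact pow_ne_zero lam (two_ne_zero (α := ℝ)) this.symm

theorem exists_Fnl_ne_zero {n : ℤ} (hn : n ≠ 0) (lam : ℕ) : ∃ x, Fnl n lam x ≠ 0 := by
  obtain ⟨y, hy⟩ : ∃ y, (physHermite lam).eval y ≠ 0 := by
    by_contra! h
    exact physHermite_ne_zero lam (Polynomial.funext fun y => by simpa using h y)
  have hpos : 0 < Real.sqrt (2 * Real.pi * |(n : ℝ)|) := by
    have : 0 < |(n : ℝ)| := by positivity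
    positivity
  refine ⟨y / Real.sqrt (2 * Real.pi * |(n : ℝ)|), ?_⟩
  rw [Fnl, mul_div_cancel₀ _ hpos.ne']
  exact_mod_cast mul_ne_zero hy (Real.exp_ne_zero _)

theorem summable_Fnl {n : ℤ} (hn : n ≠ 0) (lam : ℕ) {L : ℝ} (hL : L ≠ 0) (p : ℝ) :
    Summable fun m : ℤ => Fnl n lam (p + m / L) := by
  set a := Real.sqrt (2 * Real.pi * |(n : ℝ)|)
  set Q := (physHermite lam).comp (Polynomial.C (a * p) + Polynomial.C (a / L) * Polynomial.X)
  have hn' : 0 < |(n : ℝ)| := by positivity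
  have hT : 0 < |(n : ℝ)| / L ^ 2 := by positivity
  have hb := summable_sum (s := Q.support) fun k _ =>
    (summable_pow_mul_jacobiTheta₂_term_bound (|(n : ℝ)| * |p| / |L|) hT k).mul_left |Q.coeff k|
  refine Summable.of_norm_bounded hb fun m => ?_
  have hQ : (physHermite lam).eval (a * (p + m / L)) = Q.eval (m : ℝ) := by
    simp only [Q, Polynomial.eval_comp, Polynomial.eval_add, Polynomial.eval_mul,
      Polynomial.eval_C, Polynomial.eval_X]
    congr 1; ring
  have hE : Real.exp (-Real.pi * |(n : ℝ)| * (p + m / L) ^ 2) ≤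
      Real.exp (-Real.pi * (|(n : ℝ)| / L ^ 2 * m ^ 2 -
        2 * (|(n : ℝ)| * |p| / |L|) * |(m : ℝ)|)) := by
    apply Real.exp_le_exp.mpr
    have h1 : -(|p| * |(m : ℝ)| / |L|) ≤ p * m / L := by
      rw [← abs_mul, ← abs_div]; exact neg_abs_le _
    have h2 : (0 : ℝ) ≤ Real.pi * |(n : ℝ)| := by positivity
    have h3 := mul_le_mul_of_nonneg_left h1 h2
    have h4 : 0 ≤ Real.pi * |(n : ℝ)| * p ^ 2 := by positivity
    have e1 : -Real.pi * |(n : ℝ)| * (p + m / L) ^ 2 = -(Real.pi * |(n : ℝ)| * p ^ 2)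
      - 2 * (Real.pi * |(n : ℝ)| * (p * m / L)) - Real.pi * |(n : ℝ)| * (m ^ 2 / L ^ 2) := by
      ring
    have e2 : -Real.pi * (|(n : ℝ)| / L ^ 2 * m ^ 2 -
        2 * (|(n : ℝ)| * |p| / |L|) * |(m : ℝ)|) =
        -2 * (Real.pi * |(n : ℝ)| * -(|p| * |(m : ℝ)| / |L|)) -
          Real.pi * |(n : ℝ)| * (m ^ 2 / L ^ 2) := by
      ring
    rw [e1, e2]
    linarith
  rw [Fnl, Complex.norm_real, norm_mul, hQ, Real.norm_eq_abs, Real.norm_eq_abs,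
    abs_of_pos (Real.exp_pos _)]
  calc |Q.eval (m : ℝ)| * Real.exp (-Real.pi * |(n : ℝ)| * (p + m / L) ^ 2)
      ≤ (∑ k ∈ Q.support, |Q.coeff k| * |(m : ℝ)| ^ k) * _ := by
        refine mul_le_mul ?_ hE (Real.exp_pos _).le (by positivity)
        rw [Polynomial.eval_eq_sum, Polynomial.sum]
        refine (Finset.abs_sum_le_sum_abs _ _).trans_eq ?_
        simp [abs_mul, abs_pow]
    _ = _ := by
        rw [Finset.sum_mul]
        refine Finset.sum_congr rfl fun k _ => ?_
        push_cast
        ring_nf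

/-- Uniqueness of the coefficients of an absolutely convergent Fourier series. -/
theorem eq_zero_of_tsum_mul_fourier_eq_zero {T : ℝ} [hT : Fact (0 < T)] {a : ℤ → ℂ}
    (ha : Summable a) (h : ∀ q : ℝ, ∑' m, a m * fourier m (q : AddCircle T) = 0) (k : ℤ) :
    a k = 0 := by
  have hs : Summable fun m => a m • (fourier m : C(AddCircle T, ℂ)) := by
    refine Summable.of_norm ?_
    simpa [norm_smul, fourier_norm] using ha.norm
  have h0 : HasSum (fun m => a m • (fourier m : C(AddCircle T, ℂ))) 0 := by
    convert hs.hasSum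
    ext x
    induction x using QuotientAddGroup.induction_on with
    | H q =>
      have := ContinuousMap.tsum_apply hs (q : AddCircle T)
      simp only [ContinuousMap.coe_smul, Pi.smul_apply, smul_eq_mul] at this
      exact (this.symm.trans (h q)).symm
  have h1 := (ContinuousMap.toLp (E := ℂ) 2 AddCircle.haarAddCircle ℂ).hasSum h0
  have h2 := (innerSL ℂ (fourierLp (T := T) 2 k)).hasSum h1
  have h3 : ∀ m, inner ℂ (fourierLp (T := T) 2 k) (fourierLp 2 m) = if k = m then (1 : ℂ) else 0 :=
    fun m => orthonormal_iff_ite.mp orthonormal_fourier k m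
  simp only [map_smul, map_zero, innerSL_apply_apply] at h2
  simp only [fourierLp] at h3
  simp only [h3, smul_eq_mul, mul_ite, mul_one, mul_zero] at h2
  have h4 := hasSum_single (f := fun m => if k = m then a m else 0) k
    (fun m hm => by simp [Ne.symm hm])
  simpa using h4.unique h2

theorem summable_mul_fourier {T : ℝ} {a : ℤ → ℂ} (ha : Summable a) (q : AddCircle T) :
    Summable fun m => a m * fourier m q := by
  refine Summable.of_norm (ha.norm.congr fun m => ?_)
  rw [norm_mul, fourier_apply, Circle.norm_coe, mul_one]

theorem sign_mul_sign_self {n : ℤ} (hn : n ≠ 0) : n.sign * n.sign = 1 := by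
  rcases hn.lt_or_gt with h | h <;>
    simp [Int.sign_eq_neg_one_of_neg, Int.sign_eq_one_of_pos, h]

/-- The bijection `((j, u), k) ↦ 2l · sgn n · (|n| k + j) + u` onto the frequencies of the sum. -/
def freqEquiv {l : ℕ} (hl : 0 < l) {n : ℤ} (hn : n ≠ 0) :
    (Fin n.natAbs × Fin (2 * l)) × ℤ ≃ ℤ where
  toFun x := 2 * l * (n.sign * (|n| * x.2 + (x.1.1 : ℕ))) + (x.1.2 : ℕ)
  invFun m :=
    ((⟨((n.sign * (m / (2 * l))) % |n|).toNat, by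
        have := Int.emod_nonneg (n.sign * (m / (2 * l))) (abs_ne_zero.mpr hn)
        have := Int.emod_lt_of_pos (n.sign * (m / (2 * l))) (abs_pos.mpr hn)
        rw [Int.abs_eq_natAbs] at *
        omega⟩,
      ⟨(m % (2 * l)).toNat, by
        have := Int.emod_lt_of_pos m (show (0 : ℤ) < 2 * l by omega)
        omega⟩),
     n.sign * (m / (2 * l)) / |n|)
  left_inv := by
    rintro ⟨⟨⟨j, hj⟩, ⟨u, hu⟩⟩, k⟩
    have hL : (0 : ℤ) < 2 * l := by omega
    have hN : 0 < |n| := abs_pos.mpr hn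
    have hjN : (j : ℤ) < |n| := by rw [Int.abs_eq_natAbs]; exact_mod_cast hj
    have h1 (t : ℤ) : (2 * l * t + (u : ℤ)) / (2 * l) = t := by
      rw [add_comm, Int.add_mul_ediv_left _ _ hL.ne', Int.ediv_eq_zero_of_lt] <;> omega
    have h2 (t : ℤ) : (2 * l * t + (u : ℤ)) % (2 * l) = u := by
      rw [add_comm, Int.add_mul_emod_self_left, Int.emod_eq_of_lt] <;> omega
    have h3 : (|n| * k + (j : ℤ)) / |n| = k := by
      rw [add_comm, Int.add_mul_ediv_left _ _ hN.ne', Int.ediv_eq_zero_of_lt] <;> omega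
    have h4 : (|n| * k + (j : ℤ)) % |n| = j := by
      rw [add_comm, Int.add_mul_emod_self_left, Int.emod_eq_of_lt] <;> omega
    simp [h1, h2, h3, h4, ← mul_assoc n.sign, sign_mul_sign_self hn]
  right_inv m := by
    have h1 := Int.toNat_of_nonneg
      (Int.emod_nonneg (n.sign * (m / (2 * l))) (abs_ne_zero.mpr hn))
    have h2 := Int.toNat_of_nonneg (Int.emod_nonneg m (show (2 * l : ℤ) ≠ 0 by omega))
    simp only [h1, h2, Int.mul_ediv_add_emod, ← mul_assoc n.sign, sign_mul_sign_self hn, one_mul]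

/-- The coefficient attached to the frequency `m`. -/
def freqCoeff (l : ℕ) (n : ℤ) (c : ℤ → ℤ → ℂ) (m : ℤ) : ℂ :=
  c ((n.sign * (m / (2 * l))) % |n|) (m % (2 * l))

theorem freqCoeff_freqEquiv {l : ℕ} (hl : 0 < l) {n : ℤ} (hn : n ≠ 0) (c : ℤ → ℤ → ℂ)
    (x : (Fin n.natAbs × Fin (2 * l)) × ℤ) :
    freqCoeff l n c (freqEquiv hl hn x) = c (x.1.1 : ℕ) (x.1.2 : ℕ) := by
  have h := (freqEquiv hl hn).symm_apply_apply x
  have h1 : (((freqEquiv hl hn).symm (freqEquiv hl hn x)).1.1 : ℤ) = (x.1.1 : ℕ) := by rw [h]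
  have h2 : (((freqEquiv hl hn).symm (freqEquiv hl hn x)).1.2 : ℤ) = (x.1.2 : ℕ) := by rw [h]
  rw [freqCoeff, ← h1, ← h2]
  congr 1
  · exact (Int.toNat_of_nonneg (Int.emod_nonneg _ (abs_ne_zero.mpr hn))).symm
  · exact (Int.toNat_of_nonneg (Int.emod_nonneg _ (by omega))).symm

theorem freqEquiv_div {l : ℕ} (hl : 0 < l) {n : ℤ} (hn : n ≠ 0)
    (x : (Fin n.natAbs × Fin (2 * l)) × ℤ) :
    (freqEquiv hl hn x : ℝ) / (((2 * l : ℕ) : ℝ) * n) =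
      x.2 + ((x.1.1 : ℕ) : ℤ) / |(n : ℝ)| + ((x.1.2 : ℕ) : ℤ) / (((2 * l : ℕ) : ℝ) * n) := by
  have hn' : (n : ℝ) ≠ 0 := by exact_mod_cast hn
  have hl' : (l : ℝ) ≠ 0 := by positivity
  simp only [freqEquiv, Equiv.coe_fn_mk]
  rcases hn.lt_or_gt with h | h
  · have h' : (n : ℝ) < 0 := by exact_mod_cast h
    push_cast [Int.sign_eq_neg_one_of_neg h, abs_of_neg h']
    field_simp
    ring
  · have h' : (0 : ℝ) < n := by exact_mod_cast h
    push_cast [Int.sign_eq_one_of_pos h, abs_of_pos h']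
    field_simp

theorem norm_freqCoeff_le {l : ℕ} (hl : 0 < l) {n : ℤ} (hn : n ≠ 0) (c : ℤ → ℤ → ℂ) (m : ℤ) :
    ‖freqCoeff l n c m‖ ≤ ∑ x : Fin n.natAbs × Fin (2 * l), ‖c (x.1 : ℕ) (x.2 : ℕ)‖ := by
  obtain ⟨x, rfl⟩ := (freqEquiv hl hn).surjective m
  rw [freqCoeff_freqEquiv]
  exact Finset.single_le_sum (f := fun x : Fin n.natAbs × Fin (2 * l) => ‖c (x.1 : ℕ) (x.2 : ℕ)‖)
    (fun _ _ => norm_nonneg _) (Finset.mem_univ x.1)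

theorem summable_freqCoeff_mul_Fnl {l : ℕ} (hl : 0 < l) {n : ℤ} (hn : n ≠ 0) (lam : ℕ)
    (c : ℤ → ℤ → ℂ) (p : ℝ) :
    Summable fun m : ℤ => freqCoeff l n c m * Fnl n lam (p + m / (((2 * l : ℕ) : ℝ) * n)) := by
  have hL : ((2 * l : ℕ) : ℝ) * n ≠ 0 := by
    have : (n : ℝ) ≠ 0 := by exact_mod_cast hn
    positivity
  refine Summable.of_norm_bounded ((summable_Fnl hn lam hL p).norm.mul_left
    (∑ x : Fin n.natAbs × Fin (2 * l), ‖c (x.1 : ℕ) (x.2 : ℕ)‖)) fun m => ?_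
  rw [norm_mul]
  gcongr
  exact norm_freqCoeff_le hl hn c m

/-- The eigenfunction attached to `c`, expanded as a Fourier series in the second variable. -/
theorem sum_mul_WB_eq {l : ℕ} (hl : 0 < l) {n : ℤ} (hn : n ≠ 0) (lam : ℕ) (c : ℤ → ℤ → ℂ)
    (x : H3) :
    (∑ j ∈ Finset.range n.natAbs, ∑ u ∈ Finset.range (2 * l),
      c j u * WB (2 * l) n j u (Fnl n lam) x) =
    Complex.exp (2 * Real.pi * Complex.I * n * x.2.2) *
      ∑' m : ℤ, freqCoeff l n c m * Fnl n lam (x.1 + m / (((2 * l : ℕ) : ℝ) * n)) *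
        fourier m (x.2.1 : AddCircle (2 * l : ℝ)) := by
  have hs : Summable fun m : ℤ =>
      freqCoeff l n c m * Fnl n lam (x.1 + m / (((2 * l : ℕ) : ℝ) * n)) *
        fourier m (x.2.1 : AddCircle (2 * l : ℝ)) :=
    summable_mul_fourier (summable_freqCoeff_mul_Fnl hl hn lam c x.1) _
  have hn' : (n : ℂ) ≠ 0 := by exact_mod_cast hn
  have hl' : (l : ℂ) ≠ 0 := by exact_mod_cast hl.ne'
  have ht := ((freqEquiv hl hn).summable_iff.mpr hs).tsum_prod
  simp only [Function.comp_apply] at ht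
  rw [← (freqEquiv hl hn).tsum_eq, ht, tsum_fintype, Fintype.sum_prod_type,
    Finset.sum_range, Finset.mul_sum]
  refine Finset.sum_congr rfl fun j _ => ?_
  rw [Finset.sum_range, Finset.mul_sum]
  refine Finset.sum_congr rfl fun u _ => ?_
  rw [WB, mul_left_comm, ← tsum_mul_left]
  congr 1
  refine tsum_congr fun k => ?_
  have hm := freqEquiv_div hl hn ((j, u), k)
  simp only at hm
  rw [add_assoc x.1, add_assoc x.1, ← hm, freqCoeff_freqEquiv, fourier_coe_apply,
    mul_assoc (c _ _)]
  congr 3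
  push_cast
  field_simp

theorem exp_pi_mul_I_mul_add (n : ℤ) (lam : ℕ) :
    Complex.exp (Real.pi * Complex.I * ((n : ℂ) + (lam : ℂ))) =
      Complex.exp (Real.pi * Complex.I * n) * (-1) ^ lam := by
  rw [mul_add, Complex.exp_add, mul_comm _ (lam : ℂ), Complex.exp_nat_mul, Complex.exp_pi_mul_I]

theorem exp_pi_mul_I_mul_add_mul_self (n : ℤ) (lam : ℕ) :
    Complex.exp (Real.pi * Complex.I * ((n : ℂ) + (lam : ℂ))) *
      Complex.exp (Real.pi * Complex.I * ((n : ℂ) + (lam : ℂ))) = 1 := by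
  rw [← Complex.exp_add, Complex.exp_eq_one_iff]
  exact ⟨n + lam, by push_cast; ring⟩

theorem sum_mul_WB_phi_eq {l : ℕ} (hl : 0 < l) {n : ℤ} (hn : n ≠ 0) (lam : ℕ) (c : ℤ → ℤ → ℂ)
    (x : H3) :
    (∑ j ∈ Finset.range n.natAbs, ∑ u ∈ Finset.range (2 * l),
      c j u * WB (2 * l) n j u (Fnl n lam) (phi x)) =
    Complex.exp (2 * Real.pi * Complex.I * n * x.2.2) *
      ∑' m : ℤ, Complex.exp (Real.pi * Complex.I * ((n : ℂ) + (lam : ℂ))) *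
        freqCoeff l n c (-m) * Fnl n lam (x.1 + m / (((2 * l : ℕ) : ℝ) * n)) *
        fourier m (x.2.1 : AddCircle (2 * l : ℝ)) := by
  rw [sum_mul_WB_eq hl hn, ← (Equiv.neg ℤ).tsum_eq]
  have he : Complex.exp (2 * Real.pi * Complex.I * n * (phi x).2.2) =
      Complex.exp (2 * Real.pi * Complex.I * n * x.2.2) * Complex.exp (Real.pi * Complex.I * n) := by
    rw [← Complex.exp_add, phi]
    congr 1
    push_cast
    ring
  rw [he, mul_assoc, ← tsum_mul_left]
  congr 1
  refine tsum_congr fun m => ?_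
  have h1 : (phi x).1 + ((Equiv.neg ℤ m : ℤ) : ℝ) / (((2 * l : ℕ) : ℝ) * n) =
      -(x.1 + m / (((2 * l : ℕ) : ℝ) * n)) := by
    simp only [phi, Equiv.neg_apply]
    push_cast
    ring
  have h2 : fourier (Equiv.neg ℤ m) (((phi x).2.1 : ℝ) : AddCircle (2 * l : ℝ)) =
      fourier m (x.2.1 : AddCircle (2 * l : ℝ)) := by
    simp [phi, fourier_apply]
  rw [h1, h2, Fnl_neg, exp_pi_mul_I_mul_add, Equiv.neg_apply]
  ring

theorem sum_mul_WB_phi_invariant_iff {l : ℕ} (hl : 0 < l) {n : ℤ} (hn : n ≠ 0) (lam : ℕ)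
    (c : ℤ → ℤ → ℂ) :
    (∀ x : H3,
      (∑ j ∈ Finset.range n.natAbs, ∑ u ∈ Finset.range (2 * l),
        c j u * WB (2 * l) n j u (Fnl n lam) (phi x)) =
      ∑ j ∈ Finset.range n.natAbs, ∑ u ∈ Finset.range (2 * l),
        c j u * WB (2 * l) n j u (Fnl n lam) x) ↔
    ∀ m : ℤ, Complex.exp (Real.pi * Complex.I * ((n : ℂ) + (lam : ℂ))) * freqCoeff l n c m =
      freqCoeff l n c (-m) := by
  set ε := Complex.exp (Real.pi * Complex.I * ((n : ℂ) + (lam : ℂ))) with hε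
  have hεε : ε * ε = 1 := exp_pi_mul_I_mul_add_mul_self n lam
  constructor
  · intro h m
    have : Fact (0 < (2 * l : ℝ)) := ⟨by positivity⟩
    obtain ⟨y, hy⟩ := exists_Fnl_ne_zero hn lam
    set d := ((2 * l : ℕ) : ℝ) * n
    set p := y - m / d
    have hs : Summable fun m : ℤ => ε * freqCoeff l n c (-m) * Fnl n lam (p + m / d) := by
      have := (Equiv.neg ℤ).summable_iff.mpr (summable_freqCoeff_mul_Fnl hl hn lam c (-p))
      refine (this.mul_left (ε * (-1) ^ lam)).congr fun m => ?_
      have h1 : -p + ((-m : ℤ) : ℝ) / d = -(p + m / d) := by push_cast; ring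
      have h2 : ((-1 : ℂ) ^ lam) * (-1) ^ lam = 1 := by rw [← mul_pow]; simp
      simp only [Function.comp_apply, Equiv.neg_apply]
      rw [h1, Fnl_neg]
      linear_combination (ε * freqCoeff l n c (-m) * Fnl n lam (p + m / d)) * h2
    have hs' := summable_freqCoeff_mul_Fnl hl hn lam c p
    have key := eq_zero_of_tsum_mul_fourier_eq_zero (T := 2 * l) (hs.sub hs') (fun q => ?_) m
    · have hp : p + m / d = y := sub_add_cancel _ _
      rw [← sub_mul, hp] at key
      have := (mul_eq_zero.mp key).resolve_right hy
      linear_combination freqCoeff l n c (-m) * hεε - ε * this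
    · have hq := h (p, q, 0)
      rw [sum_mul_WB_phi_eq hl hn, sum_mul_WB_eq hl hn] at hq
      have hq := mul_left_cancel₀ (Complex.exp_ne_zero _) hq
      simp only [sub_mul]
      rw [(summable_mul_fourier hs _).tsum_sub (summable_mul_fourier hs' _)]
      exact sub_eq_zero.mpr hq
  · intro h x
    rw [sum_mul_WB_phi_eq hl hn, sum_mul_WB_eq hl hn]
    simp only [← hε, h, neg_neg]

theorem freqCoeff_neg_iff {l : ℕ} (hl : 0 < l) {n : ℤ} (hn : n ≠ 0) (c : ℤ → ℤ → ℂ) (ε : ℂ) :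
    (∀ m : ℤ, ε * freqCoeff l n c m = freqCoeff l n c (-m)) ↔
    (∀ j : ℤ, 0 ≤ j → j ≤ |n| - 1 → ε * c j 0 = c ((-j) % |n|) 0) ∧
    (∀ j u : ℤ, 0 ≤ j → j ≤ |n| - 1 → 1 ≤ u → u ≤ 2 * (l : ℤ) - 1 →
      ε * c j u = c ((-j - n.sign) % |n|) (2 * (l : ℤ) - u)) := by
  have hL : (0 : ℤ) < 2 * l := by omega
  have hc (t u : ℤ) (h0 : 0 ≤ u) (hu : u < 2 * l) :
      freqCoeff l n c (2 * l * t + u) = c ((n.sign * t) % |n|) u := by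
    rw [freqCoeff, add_comm, Int.add_mul_ediv_left _ _ hL.ne', Int.ediv_eq_zero_of_lt h0 hu,
      zero_add, Int.add_mul_emod_self_left, Int.emod_eq_of_lt h0 hu]
  have hc0 (t : ℤ) : freqCoeff l n c (-(2 * l * t + 0)) = c ((-(n.sign * t)) % |n|) 0 := by
    rw [show -(2 * (l : ℤ) * t + 0) = 2 * l * (-t) + 0 by ring, hc _ _ le_rfl hL, mul_neg]
  have hcu (t u : ℤ) (h0 : 1 ≤ u) (hu : u < 2 * l) : freqCoeff l n c (-(2 * l * t + u)) =
      c ((-(n.sign * t) - n.sign) % |n|) (2 * l - u) := by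
    rw [show -(2 * (l : ℤ) * t + u) = 2 * l * (-t - 1) + (2 * l - u) by ring,
      hc _ _ (by omega) (by omega)]
    ring_nf
  have hneg (t a : ℤ) : (-(t % |n|) - a) % |n| = (-t - a) % |n| :=
    ((Int.mod_modEq t |n|).neg.sub_right a)
  have hneg0 (t : ℤ) : (-(t % |n|)) % |n| = (-t) % |n| := (Int.mod_modEq t |n|).neg
  constructor
  · intro h
    refine ⟨fun j h0 hj => ?_, fun j u h0 hj hu hu' => ?_⟩
    · have := h (2 * l * (n.sign * j) + 0)
      rwa [hc _ _ le_rfl hL, hc0, ← mul_assoc, sign_mul_sign_self hn, one_mul,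
        Int.emod_eq_of_lt h0 (by omega)] at this
    · have := h (2 * l * (n.sign * j) + u)
      rwa [hc _ _ (by omega) (by omega), hcu _ _ hu (by omega), ← mul_assoc, sign_mul_sign_self hn, one_mul,
        Int.emod_eq_of_lt h0 (by omega)] at this
  · rintro ⟨h1, h2⟩ m
    have hm := Int.mul_ediv_add_emod m (2 * l)
    have hu0 := Int.emod_nonneg m hL.ne'
    have hu1 := Int.emod_lt_of_pos m hL
    generalize m / (2 * (l : ℤ)) = t at hm
    generalize m % (2 * (l : ℤ)) = u at hm hu0 hu1
    subst hm
    have hj0 := Int.emod_nonneg (n.sign * t) (abs_ne_zero.mpr hn)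
    have hj1 := Int.emod_lt_of_pos (n.sign * t) (abs_pos.mpr hn)
    rcases hu0.eq_or_lt with rfl | hu
    · rw [hc _ _ le_rfl hL, hc0, h1 _ hj0 (by omega), hneg0]
    · rw [hc _ _ hu0 hu1, hcu _ _ hu hu1, h2 _ _ hj0 (by omega) hu (by omega), hneg]

/-- necessary and sufficient condition on the coefficients for an
eigenfunction G = Σ c^{a,b} W_n^{a,b}F_{n,λ} (coefficients indexed by the canonical
representatives 0 ≤ j ≤ |n|−1, 0 ≤ u ≤ 2l−1 of ℤ/|n|ℤ × ℤ/2lℤ) to be φ-invariant. -/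
theorem phi_invariance_coefficients (l : ℕ) (hl : 0 < l) (n : ℤ) (hn : n ≠ 0)
    (lam : ℕ) (c : ℤ → ℤ → ℂ) :
    (0 < n →
      ((∀ x : H3,
          (∑ j ∈ Finset.range n.natAbs, ∑ u ∈ Finset.range (2 * l),
            c j u * WB (2 * l) n j u (Fnl n lam) (phi x)) =
          ∑ j ∈ Finset.range n.natAbs, ∑ u ∈ Finset.range (2 * l),
            c j u * WB (2 * l) n j u (Fnl n lam) x) ↔
        ((∀ j : ℤ, 0 ≤ j → j ≤ n - 1 →
            Complex.exp (Real.pi * Complex.I * ((n : ℂ) + (lam : ℂ))) * c j 0 =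
              c ((-j) % n) 0) ∧
         (∀ j u : ℤ, 0 ≤ j → j ≤ n - 1 → 1 ≤ u → u ≤ 2 * (l : ℤ) - 1 →
            Complex.exp (Real.pi * Complex.I * ((n : ℂ) + (lam : ℂ))) * c j u =
              c ((-j - 1) % n) (2 * (l : ℤ) - u))))) ∧
    (n < 0 →
      ((∀ x : H3,
          (∑ j ∈ Finset.range n.natAbs, ∑ u ∈ Finset.range (2 * l),
            c j u * WB (2 * l) n j u (Fnl n lam) (phi x)) =
          ∑ j ∈ Finset.range n.natAbs, ∑ u ∈ Finset.range (2 * l),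
            c j u * WB (2 * l) n j u (Fnl n lam) x) ↔
        ((∀ j : ℤ, 0 ≤ j → j ≤ |n| - 1 →
            Complex.exp (Real.pi * Complex.I * ((n : ℂ) + (lam : ℂ))) * c j 0 =
              c ((-j) % |n|) 0) ∧
         (∀ j u : ℤ, 0 ≤ j → j ≤ |n| - 1 → 1 ≤ u → u ≤ 2 * (l : ℤ) - 1 →
            Complex.exp (Real.pi * Complex.I * ((n : ℂ) + (lam : ℂ))) * c j u =
              c ((-j + 1) % |n|) (2 * (l : ℤ) - u))))) := by
  have key := (sum_mul_WB_phi_invariant_iff hl hn lam c).trans (freqCoeff_neg_iff hl hn c _)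
  refine ⟨fun h => ?_, fun h => ?_⟩
  · rw [key, Int.sign_eq_one_of_pos h, abs_of_pos h]
  · rw [key, Int.sign_eq_neg_one_of_neg h]
    simp only [sub_neg_eq_add]

end
end

section
/- Fix α ∈ [−1,1]. For t > 0 define the finite sets E(t) = {(n,λ) ∈ (ℤ∖{0}) × ℤ_{≥0} : (π|n|/2)(2λ + 1 − α·sgn n) ≤ t and |n| + λ is even} and O(t) = {(n,λ) ∈ (ℤ∖{0}) × ℤ_{≥0} : (π|n|/2)(2λ + 1 − α·sgn n) ≤ t and |n| + λ is odd}. Then for all t > 0, |#E(t) − #O(t)| ≤ 2(t/π + 1). -/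
noncomputable section

/-- E(t): pairs (n,λ) with eigenvalue ≤ t and |n| + λ even -/
def Eset (α t : ℝ) : Set (ℤ × ℕ) :=
  {p | p.1 ≠ 0 ∧
    Real.pi * |(p.1 : ℝ)| / 2 * (2 * (p.2 : ℝ) + 1 - α * (p.1.sign : ℝ)) ≤ t ∧
    Even (p.1.natAbs + p.2)}

/-- O(t): pairs (n,λ) with eigenvalue ≤ t and |n| + λ odd -/
def Oset (α t : ℝ) : Set (ℤ × ℕ) :=
  {p | p.1 ≠ 0 ∧
    Real.pi * |(p.1 : ℝ)| / 2 * (2 * (p.2 : ℝ) + 1 - α * (p.1.sign : ℝ)) ≤ t ∧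
    Odd (p.1.natAbs + p.2)}

open Finset in
/-- The alternating sum over an integer interval containing `0`. -/
theorem sum_Icc_neg_one_pow_natAbs (a b : ℕ) :
    ∑ n ∈ Icc (-(a : ℤ)) b, (-1 : ℝ) ^ n.natAbs =
      (-1) ^ a / 2 + (-1) ^ b / 2 := by
  induction b with
  | zero =>
    induction a with
    | zero => norm_num
    | succ a ih =>
      have h : Icc (-((a + 1 : ℕ) : ℤ)) ((0 : ℕ) : ℤ) =
          insert (-((a + 1 : ℕ) : ℤ)) (Icc (-(a : ℤ)) ((0 : ℕ) : ℤ)) := by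
        ext; simp only [mem_insert, mem_Icc]; omega
      rw [h, sum_insert (by simp only [mem_Icc]; omega), ih, Int.natAbs_neg, Int.natAbs_natCast]
      ring
  | succ b ih =>
    have h : Icc (-(a : ℤ)) ((b + 1 : ℕ) : ℤ) =
        insert ((b + 1 : ℕ) : ℤ) (Icc (-(a : ℤ)) (b : ℤ)) := by
      ext; simp only [mem_insert, mem_Icc]; omega
    rw [h, sum_insert (by simp only [mem_Icc]; omega), ih, Int.natAbs_natCast]
    ring

open Finset in
theorem abs_sum_Icc_erase_zero_neg_one_pow_le (a b l : ℕ) :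
    |∑ n ∈ (Icc (-(a : ℤ)) b).erase 0, (-1 : ℝ) ^ (n.natAbs + l)| ≤ 2 := by
  have h0 : (0 : ℤ) ∈ Icc (-(a : ℤ)) b := by simp
  have h := add_sum_erase _ (fun n : ℤ => (-1 : ℝ) ^ n.natAbs) h0
  rw [sum_Icc_neg_one_pow_natAbs] at h
  simp_rw [pow_add]
  rw [← sum_mul, abs_mul, abs_pow, abs_neg, abs_one, one_pow, mul_one]
  simp only [Int.natAbs_zero, pow_zero] at h
  rw [abs_le]
  rcases neg_one_pow_eq_or ℝ a with ha | ha <;> rcases neg_one_pow_eq_or ℝ b with hb | hb <;>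
    rw [ha, hb] at h <;> constructor <;> linarith

open Finset in
theorem card_filter_even_sub_card_filter_odd {ι : Type*} (s : Finset ι) (f : ι → ℕ) :
    (#{x ∈ s | Even (f x)} : ℝ) - #{x ∈ s | Odd (f x)} = ∑ x ∈ s, (-1 : ℝ) ^ f x := by
  rw [card_filter, card_filter]
  push_cast
  rw [← sum_sub_distrib]
  refine sum_congr rfl fun x _ => ?_
  rcases Nat.even_or_odd (f x) with h | h
  · simp [h, h.neg_one_pow]
  · simp [h, h.neg_one_pow, Nat.not_even_iff_odd.2 h]

theorem pi_mul_div_two_mul_le_iff {c : ℝ} (hc : 0 < c) {t : ℝ} (ht : 0 < t) (m : ℕ) :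
    Real.pi * m / 2 * c ≤ t ↔ m ≤ ⌊2 * t / (Real.pi * c)⌋₊ := by
  have hπ := Real.pi_pos
  rw [Nat.le_floor_iff (by positivity), le_div_iff₀ (by positivity)]
  constructor <;> intro h <;> linarith

/-- The spectral condition, for a fixed second coordinate, describes a punctured integer interval. -/
theorem ne_zero_and_le_iff_mem_Icc_erase {α : ℝ} (h1 : -1 < α) (h2 : α < 1) {t : ℝ} (ht : 0 < t)
    (n : ℤ) (l : ℕ) :
    (n ≠ 0 ∧ Real.pi * |(n : ℝ)| / 2 * (2 * (l : ℝ) + 1 - α * (n.sign : ℝ)) ≤ t) ↔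
      n ∈ (Finset.Icc (-(⌊2 * t / (Real.pi * (2 * l + 1 + α))⌋₊ : ℤ))
        ⌊2 * t / (Real.pi * (2 * l + 1 - α))⌋₊).erase 0 := by
  have hl : (0 : ℝ) ≤ l := l.cast_nonneg
  rw [Finset.mem_erase, Finset.mem_Icc]
  refine and_congr_right fun hn => ?_
  obtain ⟨m, rfl | rfl⟩ := n.eq_nat_or_neg
  · have hm : 0 < (m : ℤ) := by omega
    have key := pi_mul_div_two_mul_le_iff (show 0 < 2 * (l : ℝ) + 1 - α by linarith) ht m
    rw [Int.sign_eq_one_of_pos hm]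
    simp only [Int.cast_natCast, Nat.abs_cast, Int.cast_one, mul_one]
    rw [key]
    omega
  · have hm : -(m : ℤ) < 0 := by omega
    have key := pi_mul_div_two_mul_le_iff (show 0 < 2 * (l : ℝ) + 1 + α by linarith) ht m
    rw [Int.sign_eq_neg_one_of_neg hm]
    simp only [Int.cast_neg, Int.cast_natCast, abs_neg, Nat.abs_cast, Int.cast_one, mul_neg,
      mul_one, sub_neg_eq_add]
    rw [key]
    omega

theorem snd_lt_of_ne_zero_of_le {α : ℝ} (hα : α ∈ Set.Icc (-1 : ℝ) 1) {t : ℝ} (ht : 0 < t)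
    {n : ℤ} {l : ℕ} (hn : n ≠ 0)
    (h : Real.pi * |(n : ℝ)| / 2 * (2 * (l : ℝ) + 1 - α * (n.sign : ℝ)) ≤ t) :
    l < ⌊t / Real.pi⌋₊ + 1 := by
  have hπ := Real.pi_pos
  have hn1 : (1 : ℝ) ≤ |(n : ℝ)| := by exact_mod_cast Int.one_le_abs hn
  have hs : 2 * (l : ℝ) ≤ 2 * (l : ℝ) + 1 - α * (n.sign : ℝ) := by
    rcases lt_or_gt_of_ne hn with h | h
    · rw [Int.sign_eq_neg_one_of_neg h]; push_cast; linarith [hα.1]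
    · rw [Int.sign_eq_one_of_pos h]; push_cast; linarith [hα.2]
  rw [Nat.lt_add_one_iff, Nat.le_floor_iff (by positivity), le_div_iff₀ hπ]
  calc (l : ℝ) * Real.pi = Real.pi * 1 / 2 * (2 * l) := by ring
    _ ≤ Real.pi * |(n : ℝ)| / 2 * (2 * (l : ℝ) + 1 - α * (n.sign : ℝ)) := by gcongr
    _ ≤ t := h

open Finset in
theorem abs_ncard_Eset_sub_ncard_Oset_le_of_abs_lt_one {α : ℝ} (h1 : -1 < α) (h2 : α < 1)
    {t : ℝ} (ht : 0 < t) :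
    |((Eset α t).ncard : ℝ) - ((Oset α t).ncard : ℝ)| ≤ 2 * (t / Real.pi + 1) := by
  classical
  have hπ := Real.pi_pos
  let I : ℕ → Finset ℤ := fun l =>
    (Icc (-(⌊2 * t / (Real.pi * (2 * l + 1 + α))⌋₊ : ℤ))
      ⌊2 * t / (Real.pi * (2 * l + 1 - α))⌋₊).erase 0
  let s : Finset (Σ _ : ℕ, ℤ) := (range (⌊t / Real.pi⌋₊ + 1)).sigma I
  let g : (Σ _ : ℕ, ℤ) → ℤ × ℕ := fun x => (x.2, x.1)
  have hg : Function.Injective g := by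
    rintro ⟨a, b⟩ ⟨c, d⟩ h
    simp only [g, Prod.mk.injEq] at h
    rw [h.1, h.2]
  have mem_s (n : ℤ) (l : ℕ) : (⟨l, n⟩ : Σ _ : ℕ, ℤ) ∈ s ↔
      n ≠ 0 ∧ Real.pi * |(n : ℝ)| / 2 * (2 * (l : ℝ) + 1 - α * (n.sign : ℝ)) ≤ t := by
    rw [mem_sigma, mem_range, ← ne_zero_and_le_iff_mem_Icc_erase h1 h2 ht]
    exact ⟨fun h => h.2, fun h => ⟨snd_lt_of_ne_zero_of_le ⟨h1.le, h2.le⟩ ht h.1 h.2, h⟩⟩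
  have hcard (P : ℕ → Prop) [DecidablePred P] :
      {p : ℤ × ℕ | p.1 ≠ 0 ∧
        Real.pi * |(p.1 : ℝ)| / 2 * (2 * (p.2 : ℝ) + 1 - α * (p.1.sign : ℝ)) ≤ t ∧
        P (p.1.natAbs + p.2)}.ncard = #{x ∈ s | P (x.2.natAbs + x.1)} := by
    rw [← card_image_of_injective _ hg, ← Set.ncard_coe_finset]
    congr 1
    ext ⟨n, l⟩
    simp only [Set.mem_ofPred_eq, coe_image, coe_filter, Set.mem_image, Sigma.exists, g,
      Prod.mk.injEq]
    constructor
    · rintro ⟨hn, hle, hP⟩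
      exact ⟨l, n, ⟨(mem_s n l).2 ⟨hn, hle⟩, hP⟩, rfl, rfl⟩
    · rintro ⟨l, n, ⟨hs, hP⟩, rfl, rfl⟩
      have := (mem_s n l).1 hs
      exact ⟨this.1, this.2, hP⟩
  rw [Eset, Oset, hcard Even, hcard Odd, card_filter_even_sub_card_filter_odd, sum_sigma]
  calc |∑ l ∈ range (⌊t / Real.pi⌋₊ + 1), ∑ n ∈ I l, (-1 : ℝ) ^ (n.natAbs + l)|
      ≤ ∑ l ∈ range (⌊t / Real.pi⌋₊ + 1), |∑ n ∈ I l, (-1 : ℝ) ^ (n.natAbs + l)| :=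
        abs_sum_le_sum_abs _ _
    _ ≤ ∑ _l ∈ range (⌊t / Real.pi⌋₊ + 1), (2 : ℝ) :=
        sum_le_sum fun l _ => abs_sum_Icc_erase_zero_neg_one_pow_le _ _ l
    _ = 2 * (⌊t / Real.pi⌋₊ + 1) := by simp [mul_comm]
    _ ≤ 2 * (t / Real.pi + 1) := by
        gcongr
        exact Nat.floor_le (by positivity)

/-- For `α = ±1` the kernel `{λ = 0, sgn n = α}` is infinite with both parities. -/
theorem infinite_Eset_and_infinite_Oset {α : ℝ} {ε : ℤ} (hε : ε = 1 ∨ ε = -1) (hα : α = ε)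
    {t : ℝ} (ht : 0 < t) : (Eset α t).Infinite ∧ (Oset α t).Infinite := by
  have hsign (m : ℕ) (hm : 0 < m) : (ε * m).sign = ε ∧ (ε * m).natAbs = m ∧ ε * m ≠ 0 := by
    have hm' : (0 : ℤ) < m := by exact_mod_cast hm
    rcases hε with rfl | rfl
    · simp [Int.sign_eq_one_of_pos hm', hm.ne']
    · simp [Int.sign_eq_one_of_pos hm', hm.ne']
  have hle (m : ℕ) (hm : 0 < m) : Real.pi * |((ε * m : ℤ) : ℝ)| / 2 *
      (2 * ((0 : ℕ) : ℝ) + 1 - α * ((ε * m).sign : ℝ)) ≤ t := by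
    have h : (2 * ((0 : ℕ) : ℝ) + 1 - α * ((ε * m).sign : ℝ)) = 0 := by
      rw [(hsign m hm).1, hα]
      rcases hε with rfl | rfl <;> norm_num
    rw [h, mul_zero]
    exact ht.le
  have hinj (f : ℕ → ℕ) (hf : f.Injective) :
      Function.Injective fun k => ((ε * (f k : ℤ), 0) : ℤ × ℕ) := by
    intro a b h
    apply hf
    rcases hε with rfl | rfl <;> simpa using h
  constructor
  · refine Set.infinite_of_injective_forall_mem (hinj (fun k => 2 * (k + 1)) ?_) fun k => ?_
    · intro a b h
      simp only at h
      omega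
    · refine ⟨(hsign _ (by omega)).2.2, hle _ (by omega), ?_⟩
      rw [(hsign _ (by omega)).2.1]
      exact ⟨k + 1, by ring⟩
  · refine Set.infinite_of_injective_forall_mem (hinj (fun k => 2 * k + 1) ?_) fun k => ?_
    · intro a b h
      simp only at h
      omega
    · refine ⟨(hsign _ (by omega)).2.2, hle _ (by omega), ?_⟩
      rw [(hsign _ (by omega)).2.1]
      exact ⟨k, by ring⟩

/-- |#E(t) − #O(t)| ≤ 2(t/π + 1) for all t > 0. -/
theorem card_Eset_sub_card_Oset_bound (α : ℝ) (hα : α ∈ Set.Icc (-1 : ℝ) 1) :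
    ∀ t : ℝ, 0 < t →
      |((Eset α t).ncard : ℝ) - ((Oset α t).ncard : ℝ)| ≤ 2 * (t / Real.pi + 1) := by
  intro t ht
  have degenerate {ε : ℤ} (hε : ε = 1 ∨ ε = -1) (h : α = ε) :
      |((Eset α t).ncard : ℝ) - ((Oset α t).ncard : ℝ)| ≤ 2 * (t / Real.pi + 1) := by
    obtain ⟨hE, hO⟩ := infinite_Eset_and_infinite_Oset hε h ht
    rw [hE.ncard, hO.ncard, sub_self, abs_zero]
    have := Real.pi_pos
    positivity
  rcases hα.1.eq_or_lt with h1 | h1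
  · exact degenerate (Or.inr rfl) (by simp [← h1])
  rcases hα.2.eq_or_lt with h2 | h2
  · exact degenerate (Or.inl rfl) (by simp [h2])
  exact abs_ncard_Eset_sub_ncard_Oset_le_of_abs_lt_one h1 h2 ht

end
end

section
/- Let l be a positive integer, n a nonzero integer, λ a nonnegative integer, 0 ≤ j ≤ |n|−1 and 0 ≤ u ≤ 2l−1. Then, as functions on ℝ³: if n > 0, (W̃_n^{j,u}F_{n,λ,l}) ∘ ψ = (1/√(2ln)) e^{(π/2)i(n+λ)} Σ_{0 ≤ j' ≤ n−1, 0 ≤ u' ≤ 2l−1} e^{−4lnπi(j'/n + u'/(2ln))(j/n + u/(2ln))} · W̃_n^{j',u'}F_{n,λ,l}; and if n < 0, (W̃_n^{j,u}F_{n,λ,l}) ∘ ψ = (1/√(2l|n|)) e^{(π/2)i(n+3λ)} Σ_{0 ≤ j' ≤ |n|−1, 0 ≤ u' ≤ 2l−1} e^{−4lnπi(j'/|n| + u'/(2ln))(j/|n| + u/(2ln))} · W̃_n^{j',u'}F_{n,λ,l}. -/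
noncomputable section

/-- the map ψ(p,q,s) = (−q, p, s + 1/4 − pq) -/
def psi : H3 → H3 := fun x => (-x.2.1, x.1, x.2.2 + 1 / 4 - x.1 * x.2.1)

/-- S_{2l}(p,q,s) = (p/√(2l), √(2l)q, s) -/
def S2l (l : ℕ) : H3 → H3 := fun x =>
  (x.1 / Real.sqrt (2 * l), Real.sqrt (2 * l) * x.2.1, x.2.2)

/-- F_{n,λ,l}(x) = H_λ(2√(lπ|n|) x) e^{−2lπ|n|x²} -/
def Fnll (l : ℕ) (n : ℤ) (lam : ℕ) : ℝ → ℂ := fun x =>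
  (((physHermite lam).eval (2 * Real.sqrt ((l : ℝ) * Real.pi * |(n : ℝ)|) * x) *
    Real.exp (-2 * (l : ℝ) * Real.pi * |(n : ℝ)| * x ^ 2) : ℝ) : ℂ)

/-- W̃_n^{j,u}F_{n,λ,l} = (W_n^{j,u}F_{n,λ,l}) ∘ S_{2l} -/
def WBt (l : ℕ) (n j u : ℤ) (lam : ℕ) : H3 → ℂ := fun x =>
  WB (2 * l) n j u (Fnll l n lam) (S2l l x)

open Real Filter Topology MeasureTheory Asymptotics FourierTransform

/-- The product of a real polynomial with the standard Gaussian `exp (-π x²)`. -/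
def polyGauss (P : Polynomial ℝ) (x : ℝ) : ℂ :=
  ((P.eval x * Real.exp (-Real.pi * x ^ 2) : ℝ) : ℂ)

lemma polyGauss_add (P Q : Polynomial ℝ) (x : ℝ) :
    polyGauss (P + Q) x = polyGauss P x + polyGauss Q x := by
  simp [polyGauss, add_mul]

lemma polyGauss_C_mul (c : ℝ) (P : Polynomial ℝ) (x : ℝ) :
    polyGauss (Polynomial.C c * P) x = c * polyGauss P x := by
  simp [polyGauss, mul_assoc]

lemma polyGauss_X_mul (P : Polynomial ℝ) (x : ℝ) :
    polyGauss (Polynomial.X * P) x = x * polyGauss P x := by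
  simp [polyGauss, mul_assoc]

lemma continuous_polyGauss (P : Polynomial ℝ) : Continuous (polyGauss P) := by
  unfold polyGauss
  fun_prop

lemma hasDerivAt_polyGauss (P : Polynomial ℝ) (x : ℝ) :
    HasDerivAt (polyGauss P)
      (polyGauss (P.derivative - Polynomial.C (2 * Real.pi) * (Polynomial.X * P)) x) x := by
  have h : HasDerivAt (fun y : ℝ => P.eval y * Real.exp (-Real.pi * y ^ 2)) _ x :=
    (P.hasDerivAt x).mul (((hasDerivAt_pow 2 x).const_mul (-Real.pi)).exp)
  refine h.ofReal_comp.congr_deriv ?_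
  simp only [polyGauss, Polynomial.eval_sub, Polynomial.eval_mul, Polynomial.eval_C,
    Polynomial.eval_X]
  push_cast
  ring

lemma integrable_polyGauss (P : Polynomial ℝ) : Integrable (polyGauss P) := by
  induction P using Polynomial.induction_on' with
  | add P Q hP hQ => exact (hP.add hQ).congr (.of_forall fun x => (polyGauss_add P Q x).symm)
  | monomial k c =>
    have h := integrable_rpow_mul_exp_neg_mul_sq Real.pi_pos
      (lt_of_lt_of_le neg_one_lt_zero k.cast_nonneg)
    refine ((h.const_mul c).ofReal (𝕜 := ℂ)).congr (.of_forall fun x => ?_)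
    simp [polyGauss, mul_assoc]

/-- A polynomial times a Gaussian, precomposed with a nonconstant affine map, decays faster than
any power. -/
lemma polyGauss_affine_isBigO (P : Polynomial ℝ) (a : ℝ) {b : ℝ} (hb : b ≠ 0) (s : ℝ) :
    (fun t : ℝ => polyGauss P (a + b * t)) =O[cocompact ℝ] (|·| ^ s) := by
  have key : ∀ Q : Polynomial ℝ, (fun t : ℝ => ((Q.eval t : ℝ) : ℂ) *
      Complex.exp (((-Real.pi * b ^ 2 : ℝ) : ℂ) * t ^ 2 + ((-2 * Real.pi * a * b : ℝ) : ℂ) * t))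
      =O[cocompact ℝ] (|·| ^ s) := by
    intro Q
    induction Q using Polynomial.induction_on' with
    | add P Q hP hQ =>
      refine (hP.add hQ).congr_left fun t => ?_
      simp [add_mul]
    | monomial k c =>
      have hneg : (((-Real.pi * b ^ 2 : ℝ) : ℂ)).re < 0 := by
        rw [Complex.ofReal_re]
        have := mul_pos Real.pi_pos (pow_pos (abs_pos.2 hb) 2)
        rw [sq_abs] at this
        linarith
      have h1 := (cexp_neg_quadratic_isLittleO_abs_rpow_cocompact hneg
        ((-2 * Real.pi * a * b : ℝ) : ℂ) (s - k)).isBigO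
      have h2 : (fun t : ℝ => (((Polynomial.monomial k c).eval t : ℝ) : ℂ))
          =O[cocompact ℝ] fun t : ℝ => |t| ^ k := by
        refine IsBigO.of_bound |c| (.of_forall fun t => ?_)
        simp
      refine (h2.mul h1).congr' .rfl ?_
      have h0 : ∀ᶠ t : ℝ in cocompact ℝ, t ≠ 0 :=
        (isCompact_singleton (x := (0 : ℝ))).compl_mem_cocompact
      filter_upwards [h0] with t ht
      rw [← Real.rpow_natCast, ← Real.rpow_add (abs_pos.2 ht)]
      congr 1
      ring
  refine ((key (P.comp (Polynomial.C a + Polynomial.C b * Polynomial.X))).const_mul_left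
    ((Real.exp (-Real.pi * a ^ 2) : ℝ) : ℂ)).congr_left fun t => ?_
  simp only [polyGauss, Polynomial.eval_comp, Polynomial.eval_add, Polynomial.eval_mul,
    Polynomial.eval_C, Polynomial.eval_X]
  rw [mul_left_comm]
  push_cast
  rw [← Complex.exp_add]
  congr 2
  ring

/-- The Hermite polynomial rescaled so that its product with `exp (-π x²)` is an eigenfunction of
the Fourier transform. -/
def scaledHermite (lam : ℕ) : Polynomial ℝ :=
  (physHermite lam).comp (Polynomial.C (Real.sqrt (2 * Real.pi)) * Polynomial.X)

lemma scaledHermite_succ (lam : ℕ) :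
    scaledHermite (lam + 1) =
      Polynomial.C (2 * Real.sqrt (2 * Real.pi)) * (Polynomial.X * scaledHermite lam) +
        Polynomial.C (-(Real.sqrt (2 * Real.pi))⁻¹) * (scaledHermite lam).derivative := by
  have hs : Real.sqrt (2 * Real.pi) ≠ 0 := by positivity
  have hC : Polynomial.C (Real.sqrt (2 * Real.pi))⁻¹ * Polynomial.C (Real.sqrt (2 * Real.pi)) = 1 := by
    rw [← Polynomial.C_mul, inv_mul_cancel₀ hs, Polynomial.C_1]
  simp only [scaledHermite, physHermite, Polynomial.derivative_comp, Polynomial.sub_comp,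
    Polynomial.mul_comp, Polynomial.X_comp, Polynomial.derivative_C_mul, Polynomial.derivative_X,
    Polynomial.C_neg, Polynomial.C_mul, Polynomial.ofNat_comp, map_ofNat]
  linear_combination (-((physHermite lam).derivative.comp
    (Polynomial.C (Real.sqrt (2 * Real.pi)) * Polynomial.X))) * (- hC)

lemma physHermite_eval_neg (lam : ℕ) (x : ℝ) :
    (physHermite lam).eval (-x) = (-1) ^ lam * (physHermite lam).eval x := by
  have h : (physHermite lam).comp (-Polynomial.X) = (-1) ^ lam * physHermite lam := by
    induction lam with
    | zero => simp [physHermite]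
    | succ k ih =>
      have hd := congrArg Polynomial.derivative ih
      have hc : ((-1 : Polynomial ℝ)) ^ k = Polynomial.C ((-1) ^ k) := by simp
      rw [Polynomial.derivative_comp, hc, Polynomial.derivative_C_mul, ← hc] at hd
      simp only [Polynomial.derivative_neg, Polynomial.derivative_X] at hd
      simp only [physHermite, Polynomial.sub_comp, Polynomial.mul_comp, Polynomial.X_comp,
        Polynomial.ofNat_comp, ih, pow_succ]
      linear_combination hd
  simpa using congrArg (Polynomial.eval x) h

lemma polyGauss_scaledHermite_neg (lam : ℕ) (x : ℝ) :
    polyGauss (scaledHermite lam) (-x) = (-1) ^ lam * polyGauss (scaledHermite lam) x := by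
  simp [polyGauss, scaledHermite, physHermite_eval_neg, mul_assoc]

lemma polyGauss_scaledHermite_succ (lam : ℕ) (x : ℝ) :
    polyGauss (scaledHermite (lam + 1)) x =
      (Real.sqrt (2 * Real.pi) : ℂ) * (x * polyGauss (scaledHermite lam) x) -
        ((Real.sqrt (2 * Real.pi) : ℝ) : ℂ)⁻¹ * deriv (polyGauss (scaledHermite lam)) x := by
  have hs : ((Real.sqrt (2 * Real.pi) : ℝ) : ℂ) ≠ 0 := by
    exact_mod_cast (by positivity : Real.sqrt (2 * Real.pi) ≠ 0)
  have hsq : ((Real.sqrt (2 * Real.pi) : ℝ) : ℂ) ^ 2 = 2 * Real.pi := by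
    exact_mod_cast Real.sq_sqrt (by positivity : 0 ≤ 2 * Real.pi)
  rw [(hasDerivAt_polyGauss _ x).deriv, scaledHermite_succ, sub_eq_add_neg (Polynomial.derivative _),
    ← neg_mul, ← Polynomial.C_neg]
  simp only [polyGauss_add, polyGauss_C_mul, polyGauss_X_mul]
  push_cast
  rw [← hsq]
  field_simp
  ring

lemma fourier_linear_combination {f g : ℝ → ℂ} (hf : Integrable f) (hg : Integrable g)
    (c d : ℂ) (w : ℝ) :
    𝓕 (fun x => c * f x + d * g x) w = c * 𝓕 f w + d * 𝓕 g w := by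
  have hf' := (Real.fourierIntegral_convergent_iff w).2 hf
  have hg' := (Real.fourierIntegral_convergent_iff w).2 hg
  rw [Real.fourier_eq, Real.fourier_eq, Real.fourier_eq, ← integral_const_mul,
    ← integral_const_mul, ← integral_add (hf'.const_mul c) (hg'.const_mul d)]
  congr 1
  ext x
  simp only [Circle.smul_def, smul_eq_mul]
  ring

/-- Hermite functions are eigenfunctions of the Fourier transform. -/
lemma fourier_polyGauss_scaledHermite (lam : ℕ) :
    𝓕 (polyGauss (scaledHermite lam)) =
      fun x => (-Complex.I) ^ lam * polyGauss (scaledHermite lam) x := by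
  induction lam with
  | zero =>
    have h := fourier_gaussian_pi (b := 1) (by simp)
    have e : polyGauss (scaledHermite 0) = fun x : ℝ => Complex.exp (-Real.pi * 1 * (x : ℂ) ^ 2) := by
      ext x
      simp [polyGauss, scaledHermite, physHermite]
    rw [e, h]
    ext x
    simp
  | succ k ih =>
    set f := polyGauss (scaledHermite k) with hf
    have hd : deriv f = polyGauss ((scaledHermite k).derivative -
        Polynomial.C (2 * Real.pi) * (Polynomial.X * scaledHermite k)) :=
      funext fun x => (hasDerivAt_polyGauss _ x).deriv
    have hfd : Differentiable ℝ f := fun x => (hasDerivAt_polyGauss _ x).differentiableAt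
    have hfi : Integrable f := integrable_polyGauss _
    have hdi : Integrable (deriv f) := hd ▸ integrable_polyGauss _
    have hxi : Integrable (fun x : ℝ => (x : ℂ) * f x) :=
      (integrable_polyGauss (Polynomial.X * scaledHermite k)).congr
        (.of_forall fun x => polyGauss_X_mul _ x)
    have h1 := Real.fourier_deriv hfi hfd hdi
    have h2 := Real.deriv_fourier hfi (by simpa using hxi)
    have e : polyGauss (scaledHermite (k + 1)) = fun x : ℝ =>
        (Real.sqrt (2 * Real.pi) : ℂ) * ((x : ℂ) * f x) -
          ((Real.sqrt (2 * Real.pi) : ℝ) : ℂ)⁻¹ * deriv f x :=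
      funext fun x => polyGauss_scaledHermite_succ k x
    ext w
    have h1w := congrFun h1 w
    have h2w := congrFun h2 w
    rw [ih, deriv_const_mul _ (hfd w)] at h2w
    rw [ih] at h1w
    have hgi : Integrable (fun x : ℝ => (-2 * Real.pi * Complex.I * x : ℂ) • f x) :=
      (hxi.const_mul (-2 * Real.pi * Complex.I)).congr
        (.of_forall fun x => by simp only [smul_eq_mul]; ring)
    have hs : ((Real.sqrt (2 * Real.pi) : ℝ) : ℂ) ≠ 0 := by
      exact_mod_cast (by positivity : Real.sqrt (2 * Real.pi) ≠ 0)
    have hsq : (2 * Real.pi : ℂ) = ((Real.sqrt (2 * Real.pi) : ℝ) : ℂ) ^ 2 := by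
      exact_mod_cast (Real.sq_sqrt (by positivity : 0 ≤ 2 * Real.pi)).symm
    have e' : polyGauss (scaledHermite (k + 1)) = fun x : ℝ =>
        (Complex.I * ((Real.sqrt (2 * Real.pi) : ℝ) : ℂ)⁻¹) *
            ((-2 * Real.pi * Complex.I * x : ℂ) • f x) +
          (-((Real.sqrt (2 * Real.pi) : ℝ) : ℂ)⁻¹) * deriv f x := by
      rw [e]
      ext x
      rw [smul_eq_mul, neg_mul 2, hsq]
      field_simp
      linear_combination ((Real.sqrt (2 * Real.pi) : ℂ) ^ 2 * x * f x) * Complex.I_sq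
    rw [congrFun e w, e', fourier_linear_combination hgi hdi, ← h2w, h1w, smul_eq_mul, hsq]
    field_simp
    ring

lemma norm_exp_two_pi_I_mul (x : ℝ) : ‖Complex.exp (2 * Real.pi * Complex.I * x)‖ = 1 := by
  rw [show (2 * Real.pi * Complex.I * x : ℂ) = ((2 * Real.pi * x : ℝ) : ℂ) * Complex.I by
    push_cast; ring, Complex.norm_exp_ofReal_mul_I]

/-- Poisson summation for a translated, dilated and modulated Hermite function. -/
lemma tsum_polyGauss_scaledHermite (lam : ℕ) (a : ℝ) {b : ℝ} (hb : b ≠ 0) (w : ℝ) :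
    ∑' v : ℤ, polyGauss (scaledHermite lam) (a + b * v) *
        Complex.exp (2 * Real.pi * Complex.I * (v * w)) =
      ((|b|⁻¹ : ℝ) : ℂ) * (-Complex.I) ^ lam *
        ∑' k : ℤ, Complex.exp (2 * Real.pi * Complex.I * (a / b * (k - w))) *
          polyGauss (scaledHermite lam) ((k - w) / b) := by
  set F := polyGauss (scaledHermite lam) with hF
  set f : ℝ → ℂ := fun t => F (a + b * t) * Complex.exp (2 * Real.pi * Complex.I * (t * w)) with hf
  have hfour : 𝓕 f = fun ξ : ℝ => ((|b|⁻¹ : ℝ) : ℂ) * (-Complex.I) ^ lam *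
      (Complex.exp (2 * Real.pi * Complex.I * (a / b * (ξ - w))) * F ((ξ - w) / b)) := by
    ext ξ
    have h1 := congrFun (fourier_polyGauss_scaledHermite lam) ((ξ - w) / b)
    rw [← hF, Real.fourier_real_eq_integral_exp_smul] at h1
    have h2 := Measure.integral_comp_mul_left (fun y : ℝ =>
      Complex.exp (((-2 * Real.pi * (a + y) * ((ξ - w) / b) : ℝ) : ℂ) * Complex.I) • F (a + y)) b
    have h3 := integral_add_left_eq_self (μ := volume) (fun y : ℝ =>
      Complex.exp (((-2 * Real.pi * y * ((ξ - w) / b) : ℝ) : ℂ) * Complex.I) • F y) a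
    rw [h3, h1] at h2
    have h4 : 𝓕 f ξ = Complex.exp (2 * Real.pi * Complex.I * (a / b * (ξ - w))) *
        ∫ t : ℝ, Complex.exp (((-2 * Real.pi * (a + b * t) * ((ξ - w) / b) : ℝ) : ℂ) *
          Complex.I) • F (a + b * t) := by
      rw [Real.fourier_real_eq_integral_exp_smul, ← integral_const_mul]
      congr 1
      ext t
      have hb' : (b : ℂ) ≠ 0 := by exact_mod_cast hb
      rw [hf, smul_eq_mul, smul_eq_mul, mul_left_comm, ← Complex.exp_add, mul_comm,
        ← mul_assoc (Complex.exp _), ← Complex.exp_add]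
      congr 2
      push_cast
      field_simp
      ring
    rw [h4, h2, abs_inv, Complex.real_smul]
    ring
  have hfO : f =O[cocompact ℝ] (|·| ^ (-2 : ℝ)) := by
    refine IsBigO.of_norm_left ?_
    refine ((polyGauss_affine_isBigO (scaledHermite lam) a hb (-2)).norm_left).congr_left fun t => ?_
    have := norm_exp_two_pi_I_mul (t * w)
    push_cast at this
    rw [hf, norm_mul, this, mul_one]
  have hFO : 𝓕 f =O[cocompact ℝ] (|·| ^ (-2 : ℝ)) := by
    rw [hfour]
    refine IsBigO.const_mul_left (IsBigO.of_norm_left ?_) _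
    refine ((polyGauss_affine_isBigO (scaledHermite lam) (-w / b) (inv_ne_zero hb)
      (-2)).norm_left).congr_left fun ξ => ?_
    have := norm_exp_two_pi_I_mul (a / b * (ξ - w))
    push_cast at this
    rw [norm_mul, this, one_mul, show -w / b + b⁻¹ * ξ = (ξ - w) / b by ring]
  have hc : Continuous f := ((continuous_polyGauss _).comp (by fun_prop)).mul (by fun_prop)
  have h := Real.tsum_eq_tsum_fourier_of_rpow_decay hc one_lt_two hfO hFO 0
  simp only [hfour, tsum_mul_left, zero_add, AddCircle.coe_zero, fourier_eval_zero, mul_one] at h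
  simpa [hf] using h

lemma summable_polyGauss_mul_exp (P : Polynomial ℝ) (a : ℝ) {b : ℝ} (hb : b ≠ 0) (w : ℝ) :
    Summable fun v : ℤ => polyGauss P (a + b * v) *
        Complex.exp (2 * Real.pi * Complex.I * (v * w)) := by
  refine Summable.of_norm ?_
  have h : Summable fun v : ℤ => polyGauss P (a + b * v) :=
    summable_of_isBigO (Real.summable_abs_int_rpow one_lt_two)
      ((polyGauss_affine_isBigO P a hb (-2)).comp_tendsto Int.tendsto_coe_cofinite)
  refine h.norm.congr fun v => ?_
  have := norm_exp_two_pi_I_mul (v * w)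
  push_cast at this
  rw [norm_mul, this, mul_one]

lemma tsum_int_eq_sum_range_tsum {f : ℤ → ℂ} (hf : Summable f) {m : ℕ} (hm : m ≠ 0) :
    ∑' v : ℤ, f v = ∑ r ∈ Finset.range m, ∑' k : ℤ, f (m * k + r) := by
  have : NeZero m := ⟨hm⟩
  let e := (Equiv.prodComm (Fin m) ℤ).trans (Int.divModEquiv m).symm
  rw [← e.tsum_eq f, Summable.tsum_prod (f := fun c => f (e c)) (e.summable_iff.2 hf), tsum_fintype,
    Finset.sum_range fun r => ∑' k : ℤ, f (m * k + r)]
  simp [e, mul_comm]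

lemma tsum_int_sign_mul (f : ℤ → ℂ) {n : ℤ} (hn : n ≠ 0) :
    ∑' r : ℤ, f (n.sign * r) = ∑' r : ℤ, f r := by
  rcases hn.lt_or_gt with h | h
  · simp [Int.sign_eq_neg_one_of_neg h]
  · simp [Int.sign_eq_one_of_pos h]

lemma Fnll_eq_polyGauss (l : ℕ) (n : ℤ) (lam : ℕ) (t : ℝ) :
    Fnll l n lam t =
      polyGauss (scaledHermite lam) (Real.sqrt (2 * (l : ℝ) * |(n : ℝ)|) * t) := by
  have h1 : Real.sqrt (2 * Real.pi) * Real.sqrt (2 * (l : ℝ) * |(n : ℝ)|) =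
      2 * Real.sqrt ((l : ℝ) * Real.pi * |(n : ℝ)|) := by
    rw [← Real.sqrt_mul (by positivity), show 2 * Real.pi * (2 * (l : ℝ) * |(n : ℝ)|) =
      2 ^ 2 * ((l : ℝ) * Real.pi * |(n : ℝ)|) by ring, Real.sqrt_mul (by positivity),
      Real.sqrt_sq (by norm_num)]
  have h2 : Real.sqrt (2 * (l : ℝ) * |(n : ℝ)|) ^ 2 = 2 * (l : ℝ) * |(n : ℝ)| :=
    Real.sq_sqrt (by positivity)
  simp only [Fnll, polyGauss, scaledHermite, Polynomial.eval_comp, Polynomial.eval_mul,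
    Polynomial.eval_C, Polynomial.eval_X]
  rw [mul_pow, h2, ← mul_assoc, h1]
  congr 3
  ring_nf

/-- The offset `j/|n| + u/(2ln)` of the theta-like series defining `WBt`. -/
def WBtOffset (l : ℕ) (n j u : ℤ) : ℝ :=
  (j : ℝ) / |(n : ℝ)| + (u : ℝ) / (2 * (l : ℝ) * (n : ℝ))

lemma WBt_apply (l : ℕ) (n j u : ℤ) (lam : ℕ) (p q s : ℝ) :
    WBt l n j u lam (p, q, s) = Complex.exp (2 * Real.pi * Complex.I * n * s) *
      ∑' k : ℤ, Fnll l n lam (p / Real.sqrt (2 * l) + (k + WBtOffset l n j u)) *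
        Complex.exp (2 * Real.pi * Complex.I * n * (k + WBtOffset l n j u) *
          (Real.sqrt (2 * l) * q)) := by
  simp only [WBt, WB, S2l, WBtOffset]
  push_cast
  simp only [add_assoc]

lemma two_mul_mul_WBtOffset {l : ℕ} (hl : 0 < l) {n : ℤ} (hn : n ≠ 0) (j u : ℤ) :
    2 * (l : ℝ) * n * WBtOffset l n j u = ((2 * l * (n.sign * j) + u : ℤ) : ℝ) := by
  have hl' : (l : ℝ) ≠ 0 := by exact_mod_cast hl.ne'
  have hn' : (n : ℝ) ≠ 0 := by exact_mod_cast hn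
  have hs : (n : ℝ) = n.sign * |(n : ℝ)| := by exact_mod_cast (Int.sign_mul_abs n).symm
  have ha : |(n : ℝ)| ≠ 0 := abs_ne_zero.2 hn'
  have h1 : (n : ℝ) * (j / |(n : ℝ)|) = n.sign * j := by
    nth_rewrite 1 [hs]
    field_simp
  rw [WBtOffset, mul_add, mul_div_cancel₀ _ (by positivity), mul_assoc (2 * (l : ℝ)), h1]
  push_cast
  ring

/-- The exponential sum over all `WBt l n j' u' lam` collapses to a single series over `ℤ`. -/
lemma sum_exp_mul_WBt {l : ℕ} (hl : 0 < l) {n : ℤ} (hn : n ≠ 0) (lam : ℕ) (j u : ℤ)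
    (p q s : ℝ) :
    ∑ j' ∈ Finset.range n.natAbs, ∑ u' ∈ Finset.range (2 * l),
        Complex.exp (-4 * l * n * Real.pi * Complex.I * WBtOffset l n j' u' * WBtOffset l n j u) *
          WBt l n j' u' lam (p, q, s) =
      Complex.exp (2 * Real.pi * Complex.I * n * s) *
        ∑' v : ℤ, Fnll l n lam (p / Real.sqrt (2 * l) + v / (2 * l * n)) *
          Complex.exp (2 * Real.pi * Complex.I *
            (v * ((q / Real.sqrt (2 * l) - WBtOffset l n j u : ℝ) : ℂ))) := by
  have hl' : (l : ℝ) ≠ 0 := by exact_mod_cast hl.ne'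
  have hn' : (n : ℝ) ≠ 0 := by exact_mod_cast hn
  set c := Real.sqrt (2 * l) with hc
  have hc0 : c ≠ 0 := by positivity
  have hc2 : c ^ 2 = 2 * l := Real.sq_sqrt (by positivity)
  set A := WBtOffset l n j u with hA
  set g : ℤ → ℂ := fun v => Fnll l n lam (p / c + v / (2 * l * n)) *
    Complex.exp (2 * Real.pi * Complex.I * (v * ((q / c - A : ℝ) : ℂ))) with hg
  have hM : Real.sqrt (2 * (l : ℝ) * |(n : ℝ)|) ≠ 0 := by positivity
  have hgs : Summable g := by
    refine (summable_polyGauss_mul_exp (scaledHermite lam)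
      (Real.sqrt (2 * (l : ℝ) * |(n : ℝ)|) * (p / c))
      (b := Real.sqrt (2 * (l : ℝ) * |(n : ℝ)|) / (2 * l * n)) (by positivity)
      (q / c - A)).congr fun v => ?_
    simp only [hg]
    rw [Fnll_eq_polyGauss]
    congr 2
    ring
  have hsplit : ∑' v : ℤ, g v = ∑ j' ∈ Finset.range n.natAbs, ∑ u' ∈ Finset.range (2 * l),
      ∑' k : ℤ, g (2 * l * (n * k + n.sign * j') + u') := by
    rw [tsum_int_eq_sum_range_tsum hgs (m := 2 * l) (by omega), Finset.sum_comm]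
    refine Finset.sum_congr rfl fun u' _ => ?_
    have hinj : Function.Injective fun r : ℤ => 2 * (l : ℤ) * (n.sign * r) + u' := by
      intro r r' h
      have hs : n.sign ≠ 0 := Int.sign_eq_zero_iff_zero.not.2 hn
      have hl2 : 2 * (l : ℤ) ≠ 0 := by omega
      exact mul_left_cancel₀ hs (mul_left_cancel₀ hl2 (add_right_cancel h))
    have h := tsum_int_eq_sum_range_tsum (hgs.comp_injective hinj) (Int.natAbs_ne_zero.2 hn)
    rw [← tsum_int_sign_mul _ hn]
    push_cast
    refine h.trans (Finset.sum_congr rfl fun j' _ => tsum_congr fun k => ?_)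
    simp only [Function.comp_apply, mul_add, ← mul_assoc]
    rw [mul_assoc (2 * (l : ℤ)) n.sign, Int.sign_mul_natAbs]
  rw [hsplit, Finset.mul_sum]
  refine Finset.sum_congr rfl fun j' _ => ?_
  rw [Finset.mul_sum]
  refine Finset.sum_congr rfl fun u' _ => ?_
  rw [WBt_apply, mul_left_comm, ← tsum_mul_left]
  congr 1
  refine tsum_congr fun k => ?_
  set B := WBtOffset l n j' u' with hB
  have hBv : 2 * (l : ℝ) * n * (k + B) = ((2 * l * (n * k + n.sign * j') + u' : ℤ) : ℝ) := by
    rw [mul_add, hB, two_mul_mul_WBtOffset hl hn]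
    push_cast
    ring
  have hAv := two_mul_mul_WBtOffset hl hn j u
  rw [← hA] at hAv
  set v : ℤ := 2 * l * (n * k + n.sign * j') + u'
  set e : ℤ := 2 * l * (n.sign * j) + u
  rw [hg, mul_left_comm, ← Complex.exp_add]
  have harg : p / c + (k + B) = p / c + v / (2 * l * n) := by
    rw [← hBv]
    field_simp
  have hexp : -4 * l * n * Real.pi * Complex.I * B * A +
      2 * Real.pi * Complex.I * n * (k + B) * (c * q) =
      2 * Real.pi * Complex.I * (v * ((q / c - A : ℝ) : ℂ)) +
        ((e * k : ℤ) : ℂ) * (2 * Real.pi * Complex.I) := by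
    have hq : (v : ℝ) * (q / c - A) + e * k = -2 * l * n * B * A + n * (k + B) * (c * q) := by
      rw [← hBv, ← hAv]
      field_simp
      linear_combination (-(k + B) * q) * hc2
    have hq' := congrArg (fun y : ℝ => (2 * Real.pi * Complex.I) * (y : ℂ)) hq
    push_cast at hq' ⊢
    linear_combination -hq'
  rw [harg, ← hc, hexp, Complex.exp_add, Complex.exp_int_mul_two_pi_mul_I, mul_one]

lemma polyGauss_scaledHermite_sign_mul (lam : ℕ) {n : ℤ} (hn : n ≠ 0) (x : ℝ) :
    polyGauss (scaledHermite lam) (n.sign * x) =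
      (n.sign : ℂ) ^ lam * polyGauss (scaledHermite lam) x := by
  rcases hn.lt_or_gt with h | h
  · simp [Int.sign_eq_neg_one_of_neg h, polyGauss_scaledHermite_neg]
  · simp [Int.sign_eq_one_of_pos h]

lemma WBt_comp_psi_eq {l : ℕ} (hl : 0 < l) {n : ℤ} (hn : n ≠ 0) (lam : ℕ) (j u : ℤ) (x : H3) :
    WBt l n j u lam (psi x) =
      ((1 / Real.sqrt (2 * (l : ℝ) * |(n : ℝ)|) : ℝ) : ℂ) *
        (Complex.exp (Real.pi / 2 * Complex.I * n) * (n.sign * Complex.I) ^ lam) *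
        ∑ j' ∈ Finset.range n.natAbs, ∑ u' ∈ Finset.range (2 * l),
          Complex.exp (-4 * l * n * Real.pi * Complex.I * WBtOffset l n j' u' *
            WBtOffset l n j u) * WBt l n j' u' lam x := by
  obtain ⟨p, q, s⟩ := x
  have hl' : (l : ℝ) ≠ 0 := by exact_mod_cast hl.ne'
  have hn' : (n : ℝ) ≠ 0 := by exact_mod_cast hn
  rw [sum_exp_mul_WBt hl hn, psi, WBt_apply]
  dsimp only
  set c := Real.sqrt (2 * l) with hc
  have hc0 : c ≠ 0 := by positivity
  have hc2 : c ^ 2 = 2 * l := Real.sq_sqrt (by positivity)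
  set A := WBtOffset l n j u with hA
  set M := Real.sqrt (2 * (l : ℝ) * |(n : ℝ)|) with hM
  have hM0 : 0 < M := by positivity
  have hM2 : M ^ 2 = 2 * (l : ℝ) * |(n : ℝ)| := Real.sq_sqrt (by positivity)
  have hs0 : (n.sign : ℝ) ≠ 0 := by exact_mod_cast Int.sign_eq_zero_iff_zero.not.2 hn
  have hsn : (n : ℝ) = n.sign * |(n : ℝ)| := by exact_mod_cast (Int.sign_mul_abs n).symm
  have hss : ((n.sign : ℂ)) * n.sign = 1 := by
    exact_mod_cast (by rcases hn.lt_or_gt with h | h <;>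
      simp [Int.sign_eq_neg_one_of_neg, Int.sign_eq_one_of_pos, h] : n.sign * n.sign = 1)
  have hden : 2 * (l : ℝ) * n = n.sign * M ^ 2 := by
    rw [hM2]
    linear_combination (2 * (l : ℝ)) * hsn
  have hb : M / (2 * l * n) ≠ 0 := by positivity
  have hbinv : |M / (2 * l * n)|⁻¹ = M := by
    rw [abs_div, abs_mul, abs_of_pos hM0, abs_of_nonneg (by positivity : 0 ≤ 2 * (l : ℝ)), ← hM2]
    field_simp
  have hP := tsum_polyGauss_scaledHermite lam (M * (p / c)) hb (q / c - A)
  have hleft : ∀ v : ℤ, Fnll l n lam (p / c + v / (2 * l * n)) =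
      polyGauss (scaledHermite lam) (M * (p / c) + M / (2 * l * n) * v) := fun v => by
    rw [Fnll_eq_polyGauss]
    congr 1
    ring
  have hright : ∀ k : ℤ, polyGauss (scaledHermite lam) ((k - (q / c - A)) / (M / (2 * l * n))) =
      (n.sign : ℂ) ^ lam * Fnll l n lam (-q / c + (k + A)) := fun k => by
    rw [Fnll_eq_polyGauss, ← polyGauss_scaledHermite_sign_mul lam hn, hden]
    congr 1
    field_simp
    ring
  simp only [hleft, hP, hright, hbinv]
  rw [← tsum_mul_left, ← tsum_mul_left, ← tsum_mul_left, ← tsum_mul_left]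
  refine tsum_congr fun k => ?_
  have hE : Complex.exp (2 * Real.pi * Complex.I * n * ((s + 1 / 4 - p * q : ℝ) : ℂ)) *
      Complex.exp (2 * Real.pi * Complex.I * n * (k + A) * (c * p)) =
      Complex.exp (Real.pi / 2 * Complex.I * n) * Complex.exp (2 * Real.pi * Complex.I * n * s) *
      Complex.exp (2 * Real.pi * Complex.I * (((M * (p / c) : ℝ) : ℂ) /
        ((M / (2 * l * n) : ℝ) : ℂ) * (k - ((q / c - A : ℝ) : ℂ)))) := by
    have hr : (n : ℝ) * (s + 1 / 4 - p * q) + n * (k + A) * (c * p) =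
        n / 4 + n * s + M * (p / c) / (M / (2 * l * n)) * (k - (q / c - A)) := by
      rw [← hc2]
      field_simp
      ring
    have hr' := congrArg (fun y : ℝ => (2 * Real.pi * Complex.I) * (y : ℂ)) hr
    rw [← Complex.exp_add, ← Complex.exp_add, ← Complex.exp_add]
    congr 1
    push_cast at hr' ⊢
    linear_combination hr'
  have hcoef : ((1 / M : ℝ) : ℂ) * M * ((n.sign * Complex.I) ^ lam * (-Complex.I) ^ lam *
      (n.sign : ℂ) ^ lam) = 1 := by
    rw [← mul_pow, ← mul_pow, show n.sign * Complex.I * -Complex.I * n.sign = 1 by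
      linear_combination (-(n.sign : ℂ) * n.sign) * Complex.I_sq + hss, one_pow, mul_one,
      ← Complex.ofReal_mul, one_div_mul_cancel hM0.ne', Complex.ofReal_one]
  generalize Fnll l n lam (-q / c + (k + A)) = y
  linear_combination y * hE - Complex.exp (Real.pi / 2 * Complex.I * n) *
      Complex.exp (2 * Real.pi * Complex.I * n * s) *
      Complex.exp (2 * Real.pi * Complex.I * (((M * (p / c) : ℝ) : ℂ) /
        ((M / (2 * l * n) : ℝ) : ℂ) * (k - ((q / c - A : ℝ) : ℂ)))) * y * hcoef
/-- behaviour of the eigenfunctions W̃_n^{j,u}F_{n,λ,l} under pullback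
by ψ. -/
theorem WBt_comp_psi (l : ℕ) (hl : 0 < l) (n : ℤ) (hn : n ≠ 0) (lam : ℕ)
    (j u : ℤ) (hj0 : 0 ≤ j) (hj1 : j ≤ |n| - 1) (hu0 : 0 ≤ u) (hu1 : u ≤ 2 * (l : ℤ) - 1) :
    (0 < n →
      ∀ x : H3, WBt l n j u lam (psi x) =
        ((1 / Real.sqrt (2 * (l : ℝ) * (n : ℝ)) : ℝ) : ℂ) *
          Complex.exp ((Real.pi : ℂ) / 2 * Complex.I * ((n : ℂ) + (lam : ℂ))) *
          ∑ j' ∈ Finset.range n.natAbs, ∑ u' ∈ Finset.range (2 * l),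
            Complex.exp (-4 * (l : ℂ) * (n : ℂ) * (Real.pi : ℂ) * Complex.I *
                ((j' : ℂ) / (n : ℂ) + (u' : ℂ) / (2 * (l : ℂ) * (n : ℂ))) *
                ((j : ℂ) / (n : ℂ) + (u : ℂ) / (2 * (l : ℂ) * (n : ℂ)))) *
              WBt l n j' u' lam x) ∧
    (n < 0 →
      ∀ x : H3, WBt l n j u lam (psi x) =
        ((1 / Real.sqrt (2 * (l : ℝ) * |(n : ℝ)|) : ℝ) : ℂ) *
          Complex.exp ((Real.pi : ℂ) / 2 * Complex.I * ((n : ℂ) + 3 * (lam : ℂ))) *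
          ∑ j' ∈ Finset.range n.natAbs, ∑ u' ∈ Finset.range (2 * l),
            Complex.exp (-4 * (l : ℂ) * (n : ℂ) * (Real.pi : ℂ) * Complex.I *
                ((j' : ℂ) / ((|n| : ℤ) : ℂ) + (u' : ℂ) / (2 * (l : ℂ) * (n : ℂ))) *
                ((j : ℂ) / ((|n| : ℤ) : ℂ) + (u : ℂ) / (2 * (l : ℂ) * (n : ℂ)))) *
              WBt l n j' u' lam x) := by
  have hoff : ∀ j u : ℤ, ((WBtOffset l n j u : ℝ) : ℂ) =
      (j : ℂ) / ((|n| : ℤ) : ℂ) + (u : ℂ) / (2 * (l : ℂ) * (n : ℂ)) := fun j u => by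
    rw [WBtOffset, ← Int.cast_abs]
    simp only [Complex.ofReal_add, Complex.ofReal_div, Complex.ofReal_mul, Complex.ofReal_intCast,
      Complex.ofReal_natCast, Complex.ofReal_ofNat]
  constructor
  · intro h x
    have hexp : Complex.exp ((Real.pi : ℂ) / 2 * Complex.I * ((n : ℂ) + (lam : ℂ))) =
        Complex.exp (Real.pi / 2 * Complex.I * n) * (n.sign * Complex.I) ^ lam := by
      rw [Int.sign_eq_one_of_pos h, Int.cast_one, one_mul, mul_add, Complex.exp_add,
        mul_comm _ (lam : ℂ), Complex.exp_nat_mul, Complex.exp_pi_div_two_mul_I]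
    rw [WBt_comp_psi_eq hl hn, hexp]
    simp only [hoff, abs_of_pos h, abs_of_pos (Int.cast_pos.2 h : (0 : ℝ) < n), Int.cast_natCast]
  · intro h x
    have hexp : Complex.exp ((Real.pi : ℂ) / 2 * Complex.I * ((n : ℂ) + 3 * (lam : ℂ))) =
        Complex.exp (Real.pi / 2 * Complex.I * n) * (n.sign * Complex.I) ^ lam := by
      rw [Int.sign_eq_neg_one_of_neg h, mul_add, Complex.exp_add,
        show (Real.pi : ℂ) / 2 * Complex.I * (3 * lam) =
          lam * ((3 : ℕ) * (Real.pi / 2 * Complex.I)) by push_cast; ring,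
        Complex.exp_nat_mul, Complex.exp_nat_mul, Complex.exp_pi_div_two_mul_I, Complex.I_pow_three]
      simp
    rw [WBt_comp_psi_eq hl hn, hexp]
    simp only [hoff, Int.cast_natCast]

end
end
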